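/- Let β > 0, c ∈ (0,1) and n ≥ 1, and let M_n(x;β,c) be the Meixner polynomial of degree n. Then M_n(·;β,c) has n simple real roots x_{1,n}(β,c) < ... < x_{n,n}(β,c) in (0,+∞) with consecutive gaps greater than 1, and each root is strictly increasing in both parameters: if 0 < β_1 ≤ β_2 and 0 < c_1 ≤ c_2 < 1 with (β_1,c_1) ≠ (β_2,c_2), then x_{j,n}(β_1,c_1) < x_{j,n}(β_2,c_2) for every j = 1,...,n. -/

import Mathlib

open Polynomial Filter

noncomputable def deltaOp (h : ℝ) (f : ℝ → ℝ) (x : ℝ) : ℝ := f (x + h) - f x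

noncomputable def nablaOp (h : ℝ) (f : ℝ → ℝ) (x : ℝ) : ℝ := f x - f (x - h)

noncomputable def forceF (h x y : ℝ) : ℝ := 1 / (2 * h) * Real.log ((y - x + h) / (y - x - h))

noncomputable def potV (h x y : ℝ) : ℝ :=
  (x - y) / (2 * h) * Real.log ((y - x + h) / (y - x - h))
    - 1 / 2 * Real.log ((y - x + h) * (y - x - h))

noncomputable def extForce (h : ℝ) (A B : Polynomial ℝ) (x : ℝ) : ℝ :=
  1 / (2 * h) * Real.log (1 + B.eval x / A.eval x)

noncomputable def energy (h : ℝ) (φ : ℝ → ℝ) {n : ℕ} (x : Fin n → ℝ) : ℝ :=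
  (∑ j, ∑ k ∈ Finset.univ.erase j, potV h (x k) (x j)) + 2 * ∑ j, φ (x j)

def GapGt (h : ℝ) {n : ℕ} (x : Fin n → ℝ) : Prop :=
  ∀ i : ℕ, ∀ hi : i + 1 < n, x ⟨i + 1, hi⟩ - x ⟨i, Nat.lt_of_succ_lt hi⟩ > h

def SatisfiesDiffEq (h : ℝ) (A B C p : Polynomial ℝ) : Prop :=
  ∀ x : ℝ,
    A.eval x * deltaOp h (nablaOp h fun t => p.eval t) x
      + B.eval x * deltaOp h (fun t => p.eval t) x + C.eval x * p.eval x = 0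

def InIoo (a b : EReal) (y : ℝ) : Prop := a < (y : EReal) ∧ (y : EReal) < b

def IsCriticalDist (h : ℝ) (A B : Polynomial ℝ) (a b : EReal) {n : ℕ}
    (x : Fin n → ℝ) : Prop :=
  StrictMono x ∧ (∀ j, InIoo a b (x j)) ∧ GapGt h x ∧
    ∀ j, (∑ k ∈ Finset.univ.erase j, forceF h (x k) (x j)) + extForce h A B (x j) = 0

def Admissible (h : ℝ) (a b : EReal) {n : ℕ} (x : Fin n → ℝ) : Prop :=
  StrictMono x ∧ (∀ j, a ≤ (x j : EReal) ∧ (x j : EReal) ≤ b) ∧ GapGt h x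

def IsEquilibrium (h : ℝ) (φ : ℝ → ℝ) (a b : EReal) {n : ℕ} (x : Fin n → ℝ) : Prop :=
  Admissible h a b x ∧ ∀ y : Fin n → ℝ, Admissible h a b y → energy h φ x ≤ energy h φ y

noncomputable def ratFn (A B : Polynomial ℝ) (x : ℝ) : ℝ := 1 + B.eval x / A.eval x

def GConvexOn (A B : Polynomial ℝ) (a b : EReal) : Prop :=
  a < b ∧
  (∀ x : ℝ, InIoo a b x → 0 < ratFn A B x) ∧
  (∀ x y : ℝ, InIoo a b x → InIoo a b y → x < y → ratFn A B y < ratFn A B x) ∧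
  (∀ a' : ℝ, a = (a' : EReal) → A.eval a' = 0) ∧
  (a = ⊥ → (Tendsto (ratFn A B) atBot atTop ∨
      ∃ L : ℝ, 1 < L ∧ Tendsto (ratFn A B) atBot (nhds L))) ∧
  (∀ b' : ℝ, b = (b' : EReal) → (A + B).eval b' = 0) ∧
  (b = ⊤ → ∃ L : ℝ, 0 ≤ L ∧ L < 1 ∧ Tendsto (ratFn A B) atTop (nhds L))

def IsPotential (h : ℝ) (A B : Polynomial ℝ) (a b : EReal) (φ : ℝ → ℝ) : Prop :=
  ∀ x : ℝ, InIoo a b x → HasDerivAt φ (-(extForce h A B x)) x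

noncomputable def partialD {n : ℕ} (f : (Fin n → ℝ) → ℝ) (j : Fin n) (z : Fin n → ℝ) : ℝ :=
  deriv (fun t => f (Function.update z j t)) (z j)

noncomputable def poch (t : ℝ) (k : ℕ) : ℝ := (ascPochhammer ℝ k).eval t

noncomputable def negXPoch (k : ℕ) : Polynomial ℝ := (ascPochhammer ℝ k).comp (-Polynomial.X)

noncomputable def charlier (n : ℕ) (a : ℝ) : Polynomial ℝ :=
  ∑ k ∈ Finset.range (n + 1),
    Polynomial.C (poch (-(n : ℝ)) k / (k.factorial : ℝ) * (-1 / a) ^ k) * negXPoch k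

noncomputable def krawtchouk (n : ℕ) (p : ℝ) (N : ℕ) : Polynomial ℝ :=
  ∑ k ∈ Finset.range (n + 1),
    Polynomial.C (poch (-(n : ℝ)) k / ((k.factorial : ℝ) * poch (-(N : ℝ)) k) * (1 / p) ^ k) *
      negXPoch k

noncomputable def meixner (n : ℕ) (β c : ℝ) : Polynomial ℝ :=
  ∑ k ∈ Finset.range (n + 1),
    Polynomial.C (poch (-(n : ℝ)) k / ((k.factorial : ℝ) * poch β k) * (1 - 1 / c) ^ k) *
      negXPoch k

noncomputable def hahn (n : ℕ) (α β : ℝ) (N : ℕ) : Polynomial ℝ :=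
  ∑ k ∈ Finset.range (n + 1),
    Polynomial.C (poch (-(n : ℝ)) k * poch ((n : ℝ) + α + β + 1) k /
        ((k.factorial : ℝ) * poch (α + 1) k * poch (-(N : ℝ)) k)) * negXPoch k

def IsRootTuple {n : ℕ} (p : Polynomial ℝ) (x : Fin n → ℝ) : Prop :=
  StrictMono x ∧ ∀ y : ℝ, p.IsRoot y ↔ ∃ j, y = x j

lemma poch_zero (t : ℝ) : poch t 0 = 1 := by simp [poch]

lemma poch_succ (t : ℝ) (k : ℕ) : poch t (k + 1) = poch t k * (t + k) := by
  simp [poch, ascPochhammer_succ_eval]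

lemma poch_succ_left (t : ℝ) (k : ℕ) : poch t (k + 1) = t * poch (t + 1) k := by
  simp [poch, ascPochhammer_succ_left]

lemma poch_pos {t : ℝ} (ht : 0 < t) (k : ℕ) : 0 < poch t k := ascPochhammer_pos k t ht

lemma poch_neg_succ_self (n : ℕ) : poch (-(n : ℝ)) (n + 1) = 0 := by
  simp [poch_succ]

/-- The coefficient of `(-x)_k` in the Meixner polynomial. -/
noncomputable def meixnerCoeff (n : ℕ) (β c : ℝ) (k : ℕ) : ℝ :=
  poch (-(n : ℝ)) k / ((k.factorial : ℝ) * poch β k) * (1 - 1 / c) ^ k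

lemma meixner_eval (n : ℕ) (β c x : ℝ) :
    (meixner n β c).eval x = ∑ k ∈ Finset.range (n + 1), meixnerCoeff n β c k * poch (-x) k := by
  simp [meixner, eval_finsetSum, negXPoch, eval_comp, meixnerCoeff, poch]

lemma meixnerCoeff_zero (n : ℕ) (β c : ℝ) : meixnerCoeff n β c 0 = 1 := by
  simp [meixnerCoeff, poch_zero]

lemma meixnerCoeff_forward (n : ℕ) {β c : ℝ} (hβ : 0 < β) (k : ℕ) :
    meixnerCoeff (n + 1) β c (k + 1) * (k + 1)
      = -((n + 1) * (1 - 1 / c) / β * meixnerCoeff n (β + 1) c k) := by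
  have h1 : poch (-((n + 1 : ℕ) : ℝ)) (k + 1) = -((n : ℝ) + 1) * poch (-(n : ℝ)) k := by
    rw [poch_succ_left]; push_cast; ring_nf
  have h2 := (poch_pos (add_pos hβ one_pos) k).ne'
  have h3 : (k.factorial : ℝ) ≠ 0 := by positivity
  have h4 : (k : ℝ) + 1 ≠ 0 := by positivity
  unfold meixnerCoeff
  rw [h1, poch_succ_left β, Nat.factorial_succ, pow_succ]
  generalize 1 - 1 / c = z
  push_cast
  field_simp

lemma meixnerCoeff_backward (n : ℕ) {β c : ℝ} (hβ : 0 < β) (hc : 0 < c) (k : ℕ) :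
    c * (β + (k + 1)) * meixnerCoeff n (β + 1) c (k + 1) + (1 - c) * meixnerCoeff n (β + 1) c k
      = c * β * meixnerCoeff (n + 1) β c (k + 1) := by
  have h1 : poch (-((n + 1 : ℕ) : ℝ)) (k + 1) = -((n : ℝ) + 1) * poch (-(n : ℝ)) k := by
    rw [poch_succ_left]; push_cast; ring_nf
  have h2 := (poch_pos (add_pos hβ one_pos) k).ne'
  have h3 : (k.factorial : ℝ) ≠ 0 := by positivity
  have h4 : (k : ℝ) + 1 ≠ 0 := by positivity
  have h5 : β + 1 + k ≠ 0 := by positivity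
  have hz : 1 - c = -c * (1 - 1 / c) := by field_simp; ring
  unfold meixnerCoeff
  rw [h1, poch_succ_left β, Nat.factorial_succ, pow_succ, poch_succ (β + 1), poch_succ (-(n : ℝ)),
    hz]
  generalize 1 - 1 / c = z
  push_cast
  field_simp
  ring

lemma meixner_forward (n : ℕ) {β c : ℝ} (hβ : 0 < β) (x : ℝ) :
    (meixner (n + 1) β c).eval (x + 1) - (meixner (n + 1) β c).eval x
      = (n + 1) * (1 - 1 / c) / β * (meixner n (β + 1) c).eval x := by
  rw [meixner_eval, meixner_eval, meixner_eval, ← Finset.sum_sub_distrib, Finset.sum_range_succ',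
    Finset.mul_sum]
  simp only [poch_zero, sub_self, add_zero]
  refine Finset.sum_congr rfl fun k _ => ?_
  have h1 : poch (-(x + 1)) (k + 1) = (-(x + 1)) * poch (-x) k := by
    rw [poch_succ_left]; ring_nf
  rw [h1, poch_succ (-x)]
  linear_combination (-poch (-x) k) * meixnerCoeff_forward n (c := c) hβ k

lemma meixner_backward (n : ℕ) {β c : ℝ} (hβ : 0 < β) (hc : 0 < c) (x : ℝ) :
    c * (β + x) * (meixner n (β + 1) c).eval x - x * (meixner n (β + 1) c).eval (x - 1)
      = c * β * (meixner (n + 1) β c).eval x := by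
  have hz : meixnerCoeff n (β + 1) c (n + 1) = 0 := by
    simp [meixnerCoeff, poch_neg_succ_self]
  have h : c * (β + x) * (meixner n (β + 1) c).eval x - x * (meixner n (β + 1) c).eval (x - 1)
      = ∑ k ∈ Finset.range (n + 1 + 1), c * (β + k) * meixnerCoeff n (β + 1) c k * poch (-x) k
        + ∑ k ∈ Finset.range (n + 1),
            (1 - c) * meixnerCoeff n (β + 1) c k * poch (-x) (k + 1) := by
    rw [Finset.sum_range_succ, hz, meixner_eval, meixner_eval, Finset.mul_sum, Finset.mul_sum,
      ← Finset.sum_sub_distrib]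
    simp only [mul_zero, zero_mul, add_zero]
    rw [← Finset.sum_add_distrib]
    refine Finset.sum_congr rfl fun k _ => ?_
    have h1 : x * poch (-(x - 1)) k = -(poch (-x) k * (-x + k)) := by
      rw [← poch_succ, poch_succ_left]; ring_nf
    rw [poch_succ]
    linear_combination (-meixnerCoeff n (β + 1) c k) * h1
  rw [h, meixner_eval, Finset.sum_range_succ', Finset.sum_range_succ' _ (n + 1),
    mul_add (c * β), Finset.mul_sum, add_right_comm, ← Finset.sum_add_distrib, meixnerCoeff_zero,
    meixnerCoeff_zero]
  congr 1
  · refine Finset.sum_congr rfl fun k _ => ?_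
    have := meixnerCoeff_backward n hβ hc k
    push_cast
    linear_combination poch (-x) (k + 1) * this
  · simp

lemma meixner_eval_zero (n : ℕ) (β c : ℝ) : (meixner n β c).eval 0 = 1 := by
  rw [meixner_eval, Finset.sum_range_succ', meixnerCoeff_zero, poch_zero]
  simp [poch_succ_left]

lemma natDegree_meixner_le (n : ℕ) (β c : ℝ) : (meixner n β c).natDegree ≤ n := by
  refine natDegree_sum_le_of_forall_le _ _ fun k hk => ?_
  refine (natDegree_C_mul_le _ _).trans ?_
  have : (negXPoch k).natDegree = k := by
    simp [negXPoch, natDegree_comp]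
  have := Finset.mem_range.1 hk
  omega

lemma neg_one_pow_mul_prod_pos {n m : ℕ} (hm : m ≤ n) {u : ℕ → ℝ}
    (h1 : ∀ i < m, u i < 0) (h2 : ∀ i < n, m ≤ i → 0 < u i) :
    0 < (-1) ^ m * ∏ i ∈ Finset.range n, u i := by
  rw [← Finset.prod_range_mul_prod_Ico _ hm, ← mul_assoc, ← Finset.card_range m,
    ← Finset.prod_const, Finset.card_range, ← Finset.prod_mul_distrib]
  refine mul_pos (Finset.prod_pos fun i hi => ?_) (Finset.prod_pos fun i hi => ?_)
  · linarith [h1 i (Finset.mem_range.1 hi)]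
  · exact h2 i (Finset.mem_Ico.1 hi).2 (Finset.mem_Ico.1 hi).1

lemma add_one_lt_of_gaps {n : ℕ} {r : ℕ → ℝ} (hr : ∀ i, i + 1 < n → r i + 1 < r (i + 1))
    {i j : ℕ} (hij : i < j) (hj : j < n) : r i + 1 < r j := by
  induction j, hij using Nat.le_induction with
  | base => exact hr i hj
  | succ j _ ih => linarith [ih (by omega), hr j hj]

lemma exists_root_of_sign_change {p : ℝ[X]} {a b s : ℝ} (hab : a < b) (ha : 0 < s * p.eval a)
    (hb : s * p.eval b < 0) : ∃ q, a < q ∧ q < b ∧ p.eval q = 0 := by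
  have hs : s ≠ 0 := by rintro rfl; simp at ha
  have hcont : ContinuousOn (fun t => s * p.eval t) (Set.Icc a b) := by fun_prop
  obtain ⟨q, hq, h0⟩ := intermediate_value_Ioo' hab.le hcont ⟨hb, ha⟩
  exact ⟨q, hq.1, hq.2, (mul_eq_zero.1 h0).resolve_left hs⟩

lemma eval_eq_prod_of_roots {p : ℝ[X]} {n : ℕ} (hdeg : p.natDegree ≤ n) (h0 : p.eval 0 = 1)
    {r : ℕ → ℝ} (hpos : ∀ i < n, 0 < r i) (hr : ∀ i, i + 1 < n → r i + 1 < r (i + 1))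
    (hroot : ∀ i < n, p.eval (r i) = 0) (t : ℝ) :
    p.eval t = ∏ i ∈ Finset.range n, (1 - t / r i) := by
  classical
  have hinj : Set.InjOn r (Finset.range n) := by
    intro i hi j hj hij
    simp only [Finset.coe_range, Set.mem_Iio] at hi hj
    rcases lt_trichotomy i j with h | h | h
    · linarith [add_one_lt_of_gaps hr h hj]
    · exact h
    · linarith [add_one_lt_of_gaps hr h hi]
  have hnot : (0 : ℝ) ∉ (Finset.range n).image r := by
    intro h
    obtain ⟨i, hi, h⟩ := Finset.mem_image.1 h
    exact (hpos i (Finset.mem_range.1 hi)).ne' h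
  have hcard : (insert 0 ((Finset.range n).image r)).card = n + 1 := by
    rw [Finset.card_insert_of_notMem hnot, Finset.card_image_of_injOn hinj, Finset.card_range]
  have key : p = ∏ i ∈ Finset.range n, (1 - C (r i)⁻¹ * X) := by
    refine eq_of_degrees_lt_of_eval_finset_eq (insert 0 ((Finset.range n).image r)) ?_ ?_ ?_
    · rw [hcard]
      exact degree_le_natDegree.trans_lt (by exact_mod_cast Nat.lt_succ_of_le hdeg)
    · rw [hcard]
      refine degree_le_natDegree.trans_lt ?_
      have : (∏ i ∈ Finset.range n, (1 - C (r i)⁻¹ * X)).natDegree ≤ n := by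
        refine (natDegree_prod_le _ _).trans ?_
        refine (Finset.sum_le_card_nsmul _ _ 1 fun i _ => ?_).trans (by simp)
        compute_degree
      exact_mod_cast Nat.lt_succ_of_le this
    · intro x hx
      rw [eval_prod]
      rcases Finset.mem_insert.1 hx with rfl | hx
      · simp [h0]
      · obtain ⟨i, hi, rfl⟩ := Finset.mem_image.1 hx
        have hi' := Finset.mem_range.1 hi
        rw [hroot i hi', Finset.prod_eq_zero hi]
        simp [(hpos i hi').ne']
  rw [key, eval_prod]
  refine Finset.prod_congr rfl fun i _ => ?_
  simp [div_eq_inv_mul]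

lemma eventually_backward_neg {n : ℕ} {r : ℕ → ℝ} (hpos : ∀ i < n, 0 < r i) {β c : ℝ}
    (hc1 : c < 1) :
    ∀ᶠ x : ℝ in atTop, (-1) ^ n * (c * (β + x) * ∏ i ∈ Finset.range n, (1 - x / r i)
      - x * ∏ i ∈ Finset.range n, (1 - (x - 1) / r i)) < 0 := by
  have hlim : Tendsto (fun x : ℝ => c * (β / x + 1)
      - ∏ i ∈ Finset.range n, (1 + 1 / (r i - x))) atTop
      (nhds (c * (0 + 1) - ∏ _i ∈ Finset.range n, (1 + (0 : ℝ)))) := by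
    refine Tendsto.sub (((tendsto_const_nhds.div_atTop tendsto_id).add_const _).const_mul _) ?_
    refine tendsto_finsetProd _ fun i _ => Tendsto.const_add _ ?_
    refine tendsto_const_nhds.div_atBot ?_
    exact tendsto_atBot_add_const_left _ _ tendsto_neg_atTop_atBot
  have hneg := hlim.eventually_lt_const (u := 0) (by simpa using hc1)
  have hbig : ∀ᶠ x : ℝ in atTop, ∀ i ∈ Finset.range n, r i < x :=
    (Finset.eventually_all _).2 fun i _ => eventually_gt_atTop _
  filter_upwards [hneg, hbig, eventually_gt_atTop 0] with x h1 h2 h3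
  have hs : 0 < (-1) ^ n * ∏ i ∈ Finset.range n, (1 - x / r i) := by
    refine neg_one_pow_mul_prod_pos le_rfl (fun i hi => ?_) (fun i hi hi' => by omega)
    have := (one_lt_div (hpos i hi)).2 (h2 i (Finset.mem_range.2 hi))
    linarith
  have hprod : ∏ i ∈ Finset.range n, (1 - (x - 1) / r i)
      = (∏ i ∈ Finset.range n, (1 - x / r i)) * ∏ i ∈ Finset.range n, (1 + 1 / (r i - x)) := by
    rw [← Finset.prod_mul_distrib]
    refine Finset.prod_congr rfl fun i hi => ?_
    have ha := (hpos i (Finset.mem_range.1 hi)).ne'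
    have hb : r i - x ≠ 0 := by linarith [h2 i hi]
    field_simp
    ring
  rw [hprod]
  have hx : c * (β + x) = x * (c * (β / x + 1)) := by field_simp
  rw [hx]
  have := mul_neg_of_pos_of_neg (mul_pos hs h3) h1
  linarith

lemma exists_meixner_roots (n : ℕ) {c : ℝ} (hc : 0 < c) (hc1 : c < 1) :
    ∀ β : ℝ, 0 < β → ∃ r : ℕ → ℝ, (∀ i < n, 0 < r i) ∧
      (∀ i, i + 1 < n → r i + 1 < r (i + 1)) ∧
      ∀ t, (meixner n β c).eval t = ∏ i ∈ Finset.range n, (1 - t / r i) := by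
  induction n with
  | zero =>
    intro β _
    refine ⟨fun _ => 1, by simp, by simp, fun t => ?_⟩
    simp [meixner_eval, meixnerCoeff_zero, poch_zero]
  | succ n ih =>
    intro β hβ
    obtain ⟨r, hpos, hgap, hP⟩ := ih (β + 1) (by linarith)
    have hQ : ∀ x, c * β * (meixner (n + 1) β c).eval x
        = c * (β + x) * ∏ i ∈ Finset.range n, (1 - x / r i)
          - x * ∏ i ∈ Finset.range n, (1 - (x - 1) / r i) := by
      intro x
      rw [← meixner_backward n hβ hc, hP, hP]
    have hsign : ∀ m ≤ n, ∀ t : ℝ, (∀ i < m, r i < t) → (∀ i < n, m ≤ i → t < r i) →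
        0 < (-1) ^ m * ∏ i ∈ Finset.range n, (1 - t / r i) := by
      intro m hm t h1 h2
      refine neg_one_pow_mul_prod_pos hm (fun i hi => ?_) (fun i hi hi' => ?_)
      · have := (one_lt_div (hpos i (by omega))).2 (h1 i hi)
        linarith
      · have := (div_lt_one (hpos i hi)).2 (h2 i hi hi')
        linarith
    have hcb : 0 < c * β := mul_pos hc hβ
    have hvanish : ∀ i < n, ∏ k ∈ Finset.range n, (1 - r i / r k) = 0 := fun i hi =>
      Finset.prod_eq_zero (Finset.mem_range.2 hi) (by simp [(hpos i hi).ne'])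
    have hleft : ∀ i < n, 0 < (-1) ^ (i + 1) * (meixner (n + 1) β c).eval (r i + 1) := by
      intro i hi
      have hs := hsign (i + 1) hi (r i + 1)
        (fun k hk => by
          rcases Nat.lt_succ_iff_lt_or_eq.1 hk with h | rfl
          · linarith [add_one_lt_of_gaps hgap h hi]
          · linarith)
        (fun k hk hk' => add_one_lt_of_gaps hgap hk' hk)
      have h := hQ (r i + 1)
      rw [add_sub_cancel_right, hvanish i hi, mul_zero, sub_zero] at h
      have h2 : 0 < c * (β + (r i + 1)) :=
        mul_pos hc (by linarith [hpos i hi])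
      refine pos_of_mul_pos_right (a := c * β) ?_ hcb.le
      have := mul_pos h2 hs
      calc 0 < _ := this
        _ = _ := by linear_combination (-(-1) ^ (i + 1)) * h
    have hright : ∀ i < n, (-1) ^ i * (meixner (n + 1) β c).eval (r i) < 0 := by
      intro i hi
      have hs := hsign i hi.le (r i - 1)
        (fun k hk => by linarith [add_one_lt_of_gaps hgap hk hi])
        (fun k hk hk' => by
          rcases hk'.lt_or_eq with h | rfl
          · linarith [add_one_lt_of_gaps hgap h hk]
          · linarith)
      have h := hQ (r i)
      rw [hvanish i hi, mul_zero, zero_sub] at h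
      have := mul_pos (hpos i hi) hs
      refine neg_of_mul_neg_right (a := c * β) ?_ hcb.le
      calc _ = -(r i * ((-1) ^ i * ∏ k ∈ Finset.range n, (1 - (r i - 1) / r k))) := by
            linear_combination (-1) ^ i * h
        _ < 0 := by linarith
    let a : ℕ → ℝ := fun i => if i = 0 then 0 else r (i - 1) + 1
    obtain ⟨L, hL, hLa⟩ := ((eventually_backward_neg hpos (β := β) hc1).and
      (eventually_gt_atTop (a n))).exists
    let b : ℕ → ℝ := fun i => if i < n then r i else L
    have hex : ∀ i, ∃ q, i < n + 1 → a i < q ∧ q < b i ∧ (meixner (n + 1) β c).eval q = 0 := by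
      intro i
      by_cases hi : i < n + 1
      swap
      · exact ⟨0, fun h => absurd h hi⟩
      have hab : a i < b i := by
        rcases Nat.lt_succ_iff_lt_or_eq.1 hi with h | rfl
        · simp only [a, b, h, if_true]
          split_ifs with h0
          · exact hpos i h
          · exact add_one_lt_of_gaps hgap (by omega) h
        · simpa [b] using hLa
      have ha : 0 < (-1) ^ i * (meixner (n + 1) β c).eval (a i) := by
        rcases i with _ | i
        · simp [a, meixner_eval_zero]
        · simpa [a] using hleft i (by omega)
      have hb : (-1) ^ i * (meixner (n + 1) β c).eval (b i) < 0 := by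
        rcases Nat.lt_succ_iff_lt_or_eq.1 hi with h | rfl
        · simpa [b, h] using hright i h
        · rw [← hQ] at hL
          simp only [b, lt_irrefl, if_false]
          refine neg_of_mul_neg_right (a := c * β) ?_ hcb.le
          linarith
      obtain ⟨q, hq⟩ := exists_root_of_sign_change hab ha hb
      exact ⟨q, fun _ => hq⟩
    choose q hq using hex
    have hqpos : ∀ i < n + 1, 0 < q i := by
      intro i hi
      have h := (hq i hi).1
      rcases i with _ | i
      · simpa [a] using h
      · simp only [a, Nat.succ_ne_zero, if_false, Nat.add_sub_cancel] at h
        linarith [hpos i (by omega)]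
    have hqgap : ∀ i, i + 1 < n + 1 → q i + 1 < q (i + 1) := by
      intro i hi
      have h := (hq (i + 1) hi).1
      have h' := (hq i (by omega)).2.1
      simp only [a, Nat.succ_ne_zero, if_false, Nat.add_sub_cancel] at h
      simp only [b, show i < n by omega, if_true] at h'
      linarith
    exact ⟨q, hqpos, hqgap, eval_eq_prod_of_roots (natDegree_meixner_le _ _ _)
      (meixner_eval_zero _ _ _) hqpos hqgap fun i hi => (hq i hi).2.2⟩

lemma meixner_eval_add_one_of_root {n : ℕ} (hn : 1 ≤ n) {β c x : ℝ} (hβ : 0 < β) (hc : 0 < c)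
    (hx : (meixner n β c).eval x = 0) :
    c * (β + x) * (meixner n β c).eval (x + 1) + x * (meixner n β c).eval (x - 1) = 0 := by
  obtain ⟨n, rfl⟩ := Nat.exists_eq_add_of_le' hn
  have h1 := meixner_forward n (c := c) hβ x
  have h2 := meixner_forward n (c := c) hβ (x - 1)
  have h3 := meixner_backward n hβ hc x
  rw [sub_add_cancel] at h2
  rw [hx] at h1 h2 h3
  linear_combination c * (β + x) * h1 - x * h2 + (n + 1) * (1 - 1 / c) / β * h3

/-- The electrostatic equilibrium equations for the roots. -/
lemma meixner_root_equilibrium {n : ℕ} (hn : 1 ≤ n) {β c : ℝ} (hβ : 0 < β) (hc : 0 < c)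
    {x : Fin n → ℝ} (hpos : ∀ j, 0 < x j) (hgap : ∀ i j, i < j → x i + 1 < x j)
    (hp : ∀ t, (meixner n β c).eval t = ∏ i, (1 - t / x i)) (j : Fin n) :
    (∏ k ∈ Finset.univ.erase j, (x j - x k + 1) / (x j - x k - 1)) * (c * (1 + β / x j)) = 1 := by
  have hroot : (meixner n β c).eval (x j) = 0 := by
    rw [hp]
    exact Finset.prod_eq_zero (Finset.mem_univ j) (by simp [(hpos j).ne'])
  have h := meixner_eval_add_one_of_root hn hβ hc hroot
  have hj := (hpos j).ne'
  rw [hp, hp, ← Finset.mul_prod_erase _ _ (Finset.mem_univ j),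
    ← Finset.mul_prod_erase _ (fun i => 1 - (x j - 1) / x i) (Finset.mem_univ j)] at h
  have hB : ∏ k ∈ Finset.univ.erase j, (1 - (x j - 1) / x k) ≠ 0 := by
    refine Finset.prod_ne_zero_iff.2 fun k hk => ?_
    have hkj := Finset.ne_of_mem_erase hk
    have hk0 := hpos k
    rw [one_sub_div hk0.ne']
    refine div_ne_zero ?_ hk0.ne'
    rcases lt_or_gt_of_ne hkj with h | h
    · linarith [hgap _ _ h]
    · linarith [hgap _ _ h]
  have hprod : (∏ k ∈ Finset.univ.erase j, (x j - x k + 1) / (x j - x k - 1))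
      = (∏ k ∈ Finset.univ.erase j, (1 - (x j + 1) / x k))
        / ∏ k ∈ Finset.univ.erase j, (1 - (x j - 1) / x k) := by
    rw [← Finset.prod_div_distrib]
    refine Finset.prod_congr rfl fun k _ => ?_
    have hk0 := (hpos k).ne'
    rw [one_sub_div hk0, one_sub_div hk0, div_div_div_cancel_right₀ hk0, ← neg_div_neg_eq]
    ring_nf
  rw [hprod]
  generalize ∏ k ∈ Finset.univ.erase j, (1 - (x j - 1) / x k) = B at *
  generalize ∏ k ∈ Finset.univ.erase j, (1 - (x j + 1) / x k) = A at *
  field_simp at h ⊢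
  linarith

lemma add_one_div_sub_one_anti {d e : ℝ} (hde : d ≤ e) (h : 1 < d ∨ e < -1) :
    0 < (e + 1) / (e - 1) ∧ (e + 1) / (e - 1) ≤ (d + 1) / (d - 1) := by
  rcases h with h | h
  · have hd : 0 < d - 1 := by linarith
    have he : 0 < e - 1 := by linarith
    exact ⟨div_pos (by linarith) he, by rw [div_le_div_iff₀ he hd]; linarith⟩
  · have hd : d - 1 < 0 := by linarith
    have he : e - 1 < 0 := by linarith
    refine ⟨div_pos_of_neg_of_neg (by linarith) he, ?_⟩
    rw [← neg_div_neg_eq, ← neg_div_neg_eq (d + 1), div_le_div_iff₀ (by linarith) (by linarith)]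
    linarith

lemma exists_meixner_rootTuple (n : ℕ) {β c : ℝ} (hβ : 0 < β) (hc : 0 < c) (hc1 : c < 1) :
    ∃ x : Fin n → ℝ, IsRootTuple (meixner n β c) x ∧ (∀ j, 0 < x j) ∧
      (∀ i j, i < j → x i + 1 < x j) ∧ ∀ t, (meixner n β c).eval t = ∏ i, (1 - t / x i) := by
  obtain ⟨r, hpos, hgap, hp⟩ := exists_meixner_roots n hc hc1 β hβ
  have hp' : ∀ t, (meixner n β c).eval t = ∏ i : Fin n, (1 - t / r i) := fun t => by
    rw [hp, Finset.prod_range]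
  have hg : ∀ i j : Fin n, i < j → r i + 1 < r j := fun i j hij =>
    add_one_lt_of_gaps hgap hij j.2
  refine ⟨fun i => r i, ⟨fun i j hij => by linarith [hg i j hij], fun y => ?_⟩,
    fun j => hpos j j.2, hg, hp'⟩
  rw [IsRoot.def, hp', Finset.prod_eq_zero_iff]
  refine ⟨fun ⟨j, _, hj⟩ => ⟨j, ?_⟩, fun ⟨j, hj⟩ => ⟨j, Finset.mem_univ j, ?_⟩⟩
  · have := (hpos j j.2).ne'
    field_simp at hj
    linarith
  · simp [hj, (hpos j j.2).ne']

lemma IsRootTuple.unique {n : ℕ} {p : ℝ[X]} {x y : Fin n → ℝ} (hx : IsRootTuple p x)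
    (hy : IsRootTuple p y) : x = y := by
  refine (hx.1.range_inj hy.1).1 (Set.ext fun t => ?_)
  simp only [Set.mem_range, eq_comm (b := t)]
  rw [← hx.2, ← hy.2]

lemma IsRootTuple.rootMultiplicity_eq_one {n : ℕ} {p : ℝ[X]} {x : Fin n → ℝ}
    (hx : IsRootTuple p x) (hp : p ≠ 0) (hdeg : p.natDegree ≤ n) (j : Fin n) :
    p.rootMultiplicity (x j) = 1 := by
  classical
  have hle : (Finset.univ.map ⟨x, hx.1.injective⟩).val ≤ p.roots := by
    refine Finset.val_le_iff_val_subset.2 fun t ht => ?_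
    obtain ⟨i, _, rfl⟩ := Finset.mem_map.1 (Finset.mem_def.2 ht)
    exact (mem_roots hp).2 ((hx.2 _).2 ⟨i, rfl⟩)
  have heq := Multiset.eq_of_le_of_card_le hle
    (by simpa using (card_roots' p).trans hdeg)
  rw [← count_roots, ← heq]
  exact Multiset.count_eq_one_of_mem (Finset.nodup _) (by simp)

lemma meixner_roots_lt {n : ℕ} (hn : 1 ≤ n) {β₁ β₂ c₁ c₂ : ℝ} (hβ₁ : 0 < β₁) (hβ : β₁ ≤ β₂)
    (hc₁ : 0 < c₁) (hc : c₁ ≤ c₂) (hne : (β₁, c₁) ≠ (β₂, c₂)) {x y : Fin n → ℝ}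
    (hx : ∀ j, 0 < x j) (hxg : ∀ i j, i < j → x i + 1 < x j)
    (hxp : ∀ t, (meixner n β₁ c₁).eval t = ∏ i, (1 - t / x i))
    (hy : ∀ j, 0 < y j) (hyg : ∀ i j, i < j → y i + 1 < y j)
    (hyp : ∀ t, (meixner n β₂ c₂).eval t = ∏ i, (1 - t / y i)) (j : Fin n) : x j < y j := by
  have : Nonempty (Fin n) := ⟨j⟩
  obtain ⟨m, hm⟩ := Finite.exists_max fun i => x i - y i
  by_contra! hj
  have hmy : y m ≤ x m := by linarith [hm j]
  have ex := meixner_root_equilibrium hn hβ₁ hc₁ hx hxg hxp m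
  have ey := meixner_root_equilibrium hn (hβ₁.trans_le hβ) (hc₁.trans_le hc) hy hyg hyp m
  have hfac : ∀ k ∈ Finset.univ.erase m,
      0 < (x m - x k + 1) / (x m - x k - 1) ∧
        (x m - x k + 1) / (x m - x k - 1) ≤ (y m - y k + 1) / (y m - y k - 1) := by
    intro k hk
    refine add_one_div_sub_one_anti (by linarith [hm k]) ?_
    rcases lt_or_gt_of_ne (Finset.ne_of_mem_erase hk) with h | h
    · left; linarith [hyg _ _ h]
    · right; linarith [hxg _ _ h]
  have hle := Finset.prod_le_prod (fun k hk => (hfac k hk).1.le) fun k hk => (hfac k hk).2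
  have hpos := Finset.prod_pos fun k hk => (hfac k hk).1
  have hxm := hx m
  have hym := hy m
  have hlt : c₁ * (1 + β₁ / x m) < c₂ * (1 + β₂ / y m) := by
    have h1 : β₁ / x m ≤ β₁ / y m := div_le_div_of_nonneg_left hβ₁.le hym hmy
    have h2 : β₁ / y m ≤ β₂ / y m := by gcongr
    have h3 : 0 < β₁ / x m := by positivity
    rcases hc.lt_or_eq with h | h
    · exact mul_lt_mul h (by linarith) (by linarith) (by linarith)
    · have hb : β₁ < β₂ := lt_of_le_of_ne hβ fun hb => hne (by rw [hb, h])
      have h4 : β₁ / y m < β₂ / y m := by gcongr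
      rw [← h]
      exact mul_lt_mul_of_pos_left (by linarith) hc₁
  have h0 : 0 < c₁ * (1 + β₁ / x m) := by positivity
  have := mul_lt_mul' hle hlt h0.le (hpos.trans_le hle)
  linarith

/-- the Meixner polynomial `M_n(·;β,c)`, `β > 0`, `c ∈ (0,1)`, has `n` simple
real roots in `(0,∞)` with consecutive gaps greater than `1`, and the roots strictly increase
when either parameter increases. -/
theorem meixner_roots
    (β c : ℝ) (hβ : 0 < β) (hc : 0 < c) (hc1 : c < 1) (n : ℕ) (hn : 1 ≤ n) :
    (∃ x : Fin n → ℝ, IsRootTuple (meixner n β c) x ∧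
      (∀ j, (meixner n β c).rootMultiplicity (x j) = 1) ∧
      (∀ j, 0 < x j) ∧ GapGt 1 x) ∧
    (∀ β₁ β₂ c₁ c₂ : ℝ, 0 < β₁ → β₁ ≤ β₂ → 0 < c₁ → c₁ ≤ c₂ → c₂ < 1 →
      (β₁, c₁) ≠ (β₂, c₂) →
      ∀ x₁ x₂ : Fin n → ℝ,
      IsRootTuple (meixner n β₁ c₁) x₁ → IsRootTuple (meixner n β₂ c₂) x₂ →
      ∀ j, x₁ j < x₂ j) := by
  refine ⟨?_, ?_⟩
  · obtain ⟨x, hx, hpos, hgap, -⟩ := exists_meixner_rootTuple n hβ hc hc1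
    have hp : meixner n β c ≠ 0 := fun h => by
      simpa [h] using meixner_eval_zero n β c
    refine ⟨x, hx, hx.rootMultiplicity_eq_one hp (natDegree_meixner_le n β c), hpos,
      fun i hi => ?_⟩
    have := hgap ⟨i, Nat.lt_of_succ_lt hi⟩ ⟨i + 1, hi⟩ (Fin.mk_lt_mk.2 (Nat.lt_succ_self i))
    linarith
  · intro β₁ β₂ c₁ c₂ hβ₁ hβ₁₂ hc₁ hc₁₂ hc₂ hne x₁ x₂ hx₁ hx₂
    obtain ⟨x, hx, hxpos, hxgap, hxp⟩ :=
      exists_meixner_rootTuple n hβ₁ hc₁ (hc₁₂.trans_lt hc₂)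
    obtain ⟨y, hy, hypos, hygap, hyp⟩ :=
      exists_meixner_rootTuple n (hβ₁.trans_le hβ₁₂) (hc₁.trans_le hc₁₂) hc₂
    rw [hx₁.unique hx, hx₂.unique hy]
    exact meixner_roots_lt hn hβ₁ hβ₁₂ hc₁ hc₁₂ hne hxpos hxgap hxp hypos hygap hyp
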